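/- arXiv:2105.13747 — 6 statements merged into one kernel-verified Lean document; each statement's English description precedes it below -/
import Mathlib

section
/- Let A ∈ ℝ^{R×R} and C ∈ ℝ^{C×C} be positive definite diagonal matrices and B ∈ ℝ^{R×C}. For η ∈ [0,1] define the block matrix T(η) = [[A, ηB],[ηBᵀ, C]]. Let B* = A^{-1/2} B C^{-1/2} and let ρ be the spectral radius of the symmetric matrix [[0, B*],[B*ᵀ, 0]]. Then for every η with 0 ≤ η < 1/ρ, T(η) is invertible, the two matrix series below converge, and tr(T(η)^{-1}) = tr(T(0)^{-1}) + tr(A^{-1} Σ_{k≥1} (η² B* B*ᵀ)^k) + tr(C^{-1} Σ_{k≥1} (η² B*ᵀ B*)^k). -/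
open Matrix

theorem aux_summable {m : Type*} [Fintype m] [DecidableEq m] (E : Matrix m m ℝ)
    (hE : E.IsHermitian) (η : ℝ) (hη0 : 0 ≤ η) (h : η * (⨆ i, |hE.eigenvalues i|) < 1) :
    Summable (fun k : ℕ => (η ^ 2 • (E * E)) ^ (k + 1)) := by
  have hs := hE.spectral_theorem
  set U := hE.eigenvectorUnitary with hU
  set F := Unitary.conjStarAlgAut ℝ (Matrix m m ℝ) U with hF
  have hM : η ^ 2 • (E * E) = F (Matrix.diagonal (fun i => (η * hE.eigenvalues i) ^ 2)) := by
    have hd : (Matrix.diagonal (fun i => (η * hE.eigenvalues i) ^ 2) : Matrix m m ℝ)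
        = η ^ 2 • (Matrix.diagonal (RCLike.ofReal ∘ hE.eigenvalues) *
          Matrix.diagonal (RCLike.ofReal ∘ hE.eigenvalues)) := by
      rw [Matrix.diagonal_mul_diagonal, ← Matrix.diagonal_smul]
      congr 1
      funext i
      simp
      ring
    rw [hd, map_smul, map_mul, ← hs]
  have hlt : ∀ i, (η * hE.eigenvalues i) ^ 2 < 1 := by
    intro i
    have h1 : |hE.eigenvalues i| ≤ ⨆ i, |hE.eigenvalues i| :=
      le_ciSup (f := fun i => |hE.eigenvalues i|) (Set.finite_range _).bddAbove i
    rw [sq_lt_one_iff_abs_lt_one, abs_mul, abs_of_nonneg hη0]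
    exact lt_of_le_of_lt (mul_le_mul_of_nonneg_left h1 hη0) h
  have hD : Summable (fun k : ℕ => (Matrix.diagonal
      (fun i => ((η * hE.eigenvalues i) ^ 2) ^ (k + 1)) : Matrix m m ℝ)) := by
    refine Summable.matrix_diagonal (f := fun (k : ℕ) i => ((η * hE.eigenvalues i) ^ 2) ^ (k + 1)) ?_
    rw [Pi.summable]
    intro i
    exact (summable_nat_add_iff 1).2 (summable_geometric_of_lt_one (sq_nonneg _) (hlt i))
  have hD2 := (hD.mul_left (U : Matrix m m ℝ)).mul_right (star (U : Matrix m m ℝ))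
  refine hD2.congr ?_
  intro k
  rw [hM, ← map_pow, Matrix.diagonal_pow]
  rfl

theorem aux_geom {m : Type*} [Fintype m] [DecidableEq m] (P : Matrix m m ℝ)
    (h : Summable (fun k : ℕ => P ^ (k + 1))) :
    (∑' k : ℕ, P ^ (k + 1)) = P + P * ∑' k : ℕ, P ^ (k + 1) := by
  conv_lhs => rw [h.tsum_eq_zero_add]
  rw [← h.tsum_mul_left]
  simp [pow_succ']

theorem aux_blocks {m n : Type*} [Fintype m] [Fintype n] [DecidableEq m] [DecidableEq n]
    (P : Matrix m m ℝ) (Q : Matrix n n ℝ) (k : ℕ) :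
    (Matrix.fromBlocks P 0 0 Q) ^ k = Matrix.fromBlocks (P ^ k) 0 0 (Q ^ k) := by
  induction k with
  | zero => simp
  | succ k ih => simp [pow_succ, ih, Matrix.fromBlocks_multiply]

theorem aux_trace {m n : Type*} [Fintype m] [Fintype n]
    (X : Matrix m m ℝ) (Y : Matrix m n ℝ) (Z : Matrix n m ℝ) (W : Matrix n n ℝ) :
    (Matrix.fromBlocks X Y Z W).trace = X.trace + W.trace := by
  simp [Matrix.trace, Fintype.sum_sum_type]

theorem aux_inv {m n : Type*} [Fintype m] [Fintype n] [DecidableEq m] [DecidableEq n]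
    (g a : Matrix m m ℝ) (h c : Matrix n n ℝ) (hga : g * a = 1) (hhc : h * c = 1)
    (Bs : Matrix m n ℝ) (η : ℝ) (S1 : Matrix m m ℝ) (S2 : Matrix n n ℝ)
    (h1 : S1 = η ^ 2 • (Bs * Bsᵀ) + η ^ 2 • (Bs * Bsᵀ) * S1)
    (h2 : S2 = η ^ 2 • (Bsᵀ * Bs) + η ^ 2 • (Bsᵀ * Bs) * S2) :
    Matrix.fromBlocks (g * g) (η • (g * Bs * h)) (η • (h * Bsᵀ * g)) (h * h) *
    Matrix.fromBlocks (a * (1 + S1) * a) (-(η • (a * Bs * (1 + S2) * c)))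
      (-(η • (c * Bsᵀ * (1 + S1) * a))) (c * (1 + S2) * c) = 1 := by
  have gam : ∀ X : Matrix m m ℝ, g * (a * X) = X := fun X => by
    rw [← Matrix.mul_assoc, hga, Matrix.one_mul]
  have gan : ∀ X : Matrix m n ℝ, g * (a * X) = X := fun X => by
    rw [← Matrix.mul_assoc, hga, Matrix.one_mul]
  have hcm : ∀ X : Matrix n m ℝ, h * (c * X) = X := fun X => by
    rw [← Matrix.mul_assoc, hhc, Matrix.one_mul]
  have hcn : ∀ X : Matrix n n ℝ, h * (c * X) = X := fun X => by
    rw [← Matrix.mul_assoc, hhc, Matrix.one_mul]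
  have e1 : (1 + S1) - η ^ 2 • (Bs * (Bsᵀ * (1 + S1))) = 1 := by
    conv_lhs => enter [1]; rw [h1]
    simp only [Matrix.mul_add, Matrix.mul_one, smul_add, Matrix.smul_mul, Matrix.mul_assoc]
    abel
  have e2 : (1 + S2) - η ^ 2 • (Bsᵀ * (Bs * (1 + S2))) = 1 := by
    conv_lhs => enter [1]; rw [h2]
    simp only [Matrix.mul_add, Matrix.mul_one, smul_add, Matrix.smul_mul, Matrix.mul_assoc]
    abel
  rw [Matrix.fromBlocks_multiply, ← Matrix.fromBlocks_one]
  congr 1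
  · have : g * ((1 + S1) - η ^ 2 • (Bs * (Bsᵀ * (1 + S1)))) * a = 1 := by
      rw [e1, Matrix.mul_one, hga]
    refine Eq.trans ?_ this
    simp only [Matrix.mul_assoc, Matrix.smul_mul, Matrix.mul_smul, Matrix.mul_neg, gam, gan, hcm, hcn,
      smul_smul, pow_two, sub_eq_add_neg, Matrix.neg_mul, Matrix.mul_add, Matrix.add_mul, smul_add]
  · simp only [Matrix.mul_assoc, Matrix.smul_mul, Matrix.mul_smul, Matrix.mul_neg, gam, gan, hcm, hcn]
    abel
  · simp only [Matrix.mul_assoc, Matrix.smul_mul, Matrix.mul_smul, Matrix.mul_neg, gam, gan, hcm, hcn]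
    abel
  · have : h * ((1 + S2) - η ^ 2 • (Bsᵀ * (Bs * (1 + S2)))) * c = 1 := by
      rw [e2, Matrix.mul_one, hhc]
    refine Eq.trans ?_ this
    simp only [Matrix.mul_assoc, Matrix.smul_mul, Matrix.mul_smul, Matrix.mul_neg, gam, gan, hcm, hcn,
      smul_smul, pow_two, sub_eq_add_neg, Matrix.neg_mul, Matrix.mul_add, Matrix.add_mul, smul_add]
    abel

/-- For positive definite diagonal `A ∈ ℝ^{R×R}`, `C ∈ ℝ^{C×C}` and
`B ∈ ℝ^{R×C}`, set `T(η) = [[A, ηB],[ηBᵀ, C]]`, `B* = A^{-1/2} B C^{-1/2}`, and let `ρ` be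
the spectral radius (maximum absolute eigenvalue) of the symmetric matrix
`[[0, B*],[B*ᵀ, 0]]`.  Then for every `η` with `0 ≤ η < 1/ρ` (encoded as `η·ρ < 1`, which
also covers `ρ = 0`, where `1/ρ = ∞`), `T(η)` is invertible, the two matrix series
converge, and
`tr(T(η)⁻¹) = tr(T(0)⁻¹) + tr(A⁻¹ Σ_{k≥1} (η² B* B*ᵀ)^k) + tr(C⁻¹ Σ_{k≥1} (η² B*ᵀ B*)^k)`. -/
theorem stmt0 {m n : Type*} [Fintype m] [Fintype n] [DecidableEq m] [DecidableEq n]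
    [Nonempty m] [Nonempty n]
    (dA : m → ℝ) (dC : n → ℝ) (hdA : ∀ i, 0 < dA i) (hdC : ∀ j, 0 < dC j)
    (B Bs : Matrix m n ℝ)
    (hBs : Bs = Matrix.diagonal (fun i => (Real.sqrt (dA i))⁻¹) * B *
      Matrix.diagonal (fun j => (Real.sqrt (dC j))⁻¹))
    (hE : (Matrix.fromBlocks 0 Bs Bsᵀ (0 : Matrix n n ℝ)).IsHermitian)
    (ρ : ℝ) (hρ : ρ = ⨆ i, |hE.eigenvalues i|)
    (T : ℝ → Matrix (m ⊕ n) (m ⊕ n) ℝ)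
    (hT : ∀ η, T η = Matrix.fromBlocks (Matrix.diagonal dA) (η • B) (η • Bᵀ)
      (Matrix.diagonal dC))
    (η : ℝ) (hη0 : 0 ≤ η) (hη1 : η * ρ < 1) :
    IsUnit (T η) ∧
    Summable (fun k : ℕ => (η ^ 2 • (Bs * Bsᵀ)) ^ (k + 1)) ∧
    Summable (fun k : ℕ => (η ^ 2 • (Bsᵀ * Bs)) ^ (k + 1)) ∧
    (T η)⁻¹.trace = (T 0)⁻¹.trace
      + (Matrix.diagonal (fun i => (dA i)⁻¹) * ∑' k : ℕ, (η ^ 2 • (Bs * Bsᵀ)) ^ (k + 1)).trace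
      + (Matrix.diagonal (fun j => (dC j)⁻¹) * ∑' k : ℕ, (η ^ 2 • (Bsᵀ * Bs)) ^ (k + 1)).trace := by
  have hsum := aux_summable _ hE η hη0 (hρ ▸ hη1)
  have hbl : ∀ k : ℕ, (η ^ 2 • (Matrix.fromBlocks 0 Bs Bsᵀ (0 : Matrix n n ℝ) *
      Matrix.fromBlocks 0 Bs Bsᵀ (0 : Matrix n n ℝ))) ^ (k + 1) =
      Matrix.fromBlocks ((η ^ 2 • (Bs * Bsᵀ)) ^ (k + 1)) 0 0
        ((η ^ 2 • (Bsᵀ * Bs)) ^ (k + 1)) := by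
    intro k
    rw [← aux_blocks]
    simp [Matrix.fromBlocks_multiply, Matrix.fromBlocks_smul]
  simp_rw [hbl] at hsum
  have hs1 : Summable (fun k : ℕ => (η ^ 2 • (Bs * Bsᵀ)) ^ (k + 1)) := by
    refine Pi.summable.2 fun i => Pi.summable.2 fun j => ?_
    exact Pi.summable.1 (Pi.summable.1 hsum (Sum.inl i)) (Sum.inl j)
  have hs2 : Summable (fun k : ℕ => (η ^ 2 • (Bsᵀ * Bs)) ^ (k + 1)) := by
    refine Pi.summable.2 fun i => Pi.summable.2 fun j => ?_
    exact Pi.summable.1 (Pi.summable.1 hsum (Sum.inr i)) (Sum.inr j)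
  have hA0 : ∀ i, Real.sqrt (dA i) ≠ 0 := fun i => (Real.sqrt_pos.2 (hdA i)).ne'
  have hC0 : ∀ i, Real.sqrt (dC i) ≠ 0 := fun i => (Real.sqrt_pos.2 (hdC i)).ne'
  set g : Matrix m m ℝ := Matrix.diagonal (fun i => Real.sqrt (dA i)) with hg
  set a : Matrix m m ℝ := Matrix.diagonal (fun i => (Real.sqrt (dA i))⁻¹) with ha
  set h : Matrix n n ℝ := Matrix.diagonal (fun i => Real.sqrt (dC i)) with hh
  set c : Matrix n n ℝ := Matrix.diagonal (fun i => (Real.sqrt (dC i))⁻¹) with hc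
  have hga : g * a = 1 := by simp [hg, ha, Matrix.diagonal_mul_diagonal, hA0]
  have hhc : h * c = 1 := by simp [hh, hc, Matrix.diagonal_mul_diagonal, hC0]
  have hch : c * h = 1 := by simp [hh, hc, Matrix.diagonal_mul_diagonal, hC0]
  have hgg : g * g = Matrix.diagonal dA := by
    simp [hg, Matrix.diagonal_mul_diagonal, fun i => Real.mul_self_sqrt (hdA i).le]
  have hhh : h * h = Matrix.diagonal dC := by
    simp [hh, Matrix.diagonal_mul_diagonal, fun i => Real.mul_self_sqrt (hdC i).le]
  have haa : a * a = Matrix.diagonal (fun i => (dA i)⁻¹) := by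
    simp [ha, Matrix.diagonal_mul_diagonal, ← mul_inv, fun i => Real.mul_self_sqrt (hdA i).le]
  have hcc : c * c = Matrix.diagonal (fun i => (dC i)⁻¹) := by
    simp [hc, Matrix.diagonal_mul_diagonal, ← mul_inv, fun i => Real.mul_self_sqrt (hdC i).le]
  have hB : g * Bs * h = B := by
    rw [hBs, Matrix.mul_assoc, Matrix.mul_assoc, hch, Matrix.mul_one, ← Matrix.mul_assoc, hga,
      Matrix.one_mul]
  have hBt : h * Bsᵀ * g = Bᵀ := by
    rw [← hB, Matrix.transpose_mul, Matrix.transpose_mul, Matrix.mul_assoc]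
    simp [hg, hh]
  clear_value g a h c
  have key := aux_inv g a h c hga hhc Bs η _ _ (aux_geom _ hs1) (aux_geom _ hs2)
  have key0 := aux_inv g a h c hga hhc Bs 0 0 0 (by simp) (by simp)
  rw [hB, hBt, hgg, hhh, ← hT] at key key0
  refine ⟨IsUnit.of_mul_eq_one _ key, hs1, hs2, ?_⟩
  rw [Matrix.inv_eq_right_inv key, Matrix.inv_eq_right_inv key0, aux_trace,
    aux_trace, ← haa, ← hcc]
  generalize (∑' k : ℕ, (η ^ 2 • (Bs * Bsᵀ)) ^ (k + 1)) = S1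
  generalize (∑' k : ℕ, (η ^ 2 • (Bsᵀ * Bs)) ^ (k + 1)) = S2
  rw [Matrix.trace_mul_comm (a * (1 + S1)) a, Matrix.trace_mul_comm (c * (1 + S2)) c]
  simp only [Matrix.mul_add, Matrix.mul_one, Matrix.trace_add, add_zero, Matrix.mul_assoc]
  ring
end

section
/- Let R, C ≥ 1, let Z ∈ {0,1}^{R×C}, and let W_{ij} ≥ 0 be weights with W_{ij} > 0 whenever Z_{ij} = 1. Define row sums W_{i·} = Σ_j Z_{ij} W_{ij} and column sums W_{·j} = Σ_i Z_{ij} W_{ij}, and assume every row and every column of Z contains at least one 1 (so all W_{i·} > 0 and W_{·j} > 0). For σ_A, σ_B > 0 let A = diag(W_{i·} + σ_A^{-2}), C̃ = diag(W_{·j} + σ_B^{-2}), let B have entries Z_{ij} W_{ij}, and let B* = A^{-1/2} B C̃^{-1/2}. Then the spectral radius ρ of [[0, B*],[B*ᵀ, 0]] satisfies ρ ≤ (max_i W_{i·}/(W_{i·} + σ_A^{-2}))^{1/2} · (max_j W_{·j}/(W_{·j} + σ_B^{-2}))^{1/2} < 1. -/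
open Matrix

lemma aux_eig {R C : Type*} [Fintype R] [Fintype C]
    (b : R → C → ℝ) (hb : ∀ i j, 0 ≤ b i j) (a : R → ℝ) (c : C → ℝ)
    (ha : ∀ i, 0 < a i) (hc : ∀ j, 0 < c j) (α β : ℝ) (hα0 : 0 ≤ α) (hβ0 : 0 ≤ β)
    (hα : ∀ i, (∑ j, b i j) / a i ≤ α) (hβ : ∀ j, (∑ i, b i j) / c j ≤ β)
    (x : R → ℝ) (y : C → ℝ) (l : ℝ)
    (h1 : ∀ i, ∑ j, (Real.sqrt (a i))⁻¹ * b i j * (Real.sqrt (c j))⁻¹ * y j = l * x i)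
    (h2 : ∀ j, ∑ i, (Real.sqrt (a i))⁻¹ * b i j * (Real.sqrt (c j))⁻¹ * x i = l * y j)
    (hne : 0 < ∑ i, x i ^ 2 + ∑ j, y j ^ 2) : |l| ≤ Real.sqrt α * Real.sqrt β := by
  rw [← Real.sqrt_mul hα0]
  apply Real.abs_le_sqrt
  by_cases hl : l = 0
  · rw [hl]; simpa using mul_nonneg hα0 hβ0
  set S := ∑ p : R × C, (Real.sqrt (a p.1))⁻¹ * b p.1 p.2 * (Real.sqrt (c p.2))⁻¹ * x p.1 * y p.2
    with hS
  set X := ∑ i, x i ^ 2 with hX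
  set Y := ∑ j, y j ^ 2 with hY
  have e1 : S = l * X := by
    rw [hS, Fintype.sum_prod_type, hX, Finset.mul_sum]
    refine Finset.sum_congr rfl fun i _ => ?_
    rw [show l * x i ^ 2 = x i * (l * x i) by ring, ← h1, Finset.mul_sum]
    exact Finset.sum_congr rfl fun j _ => by ring
  have e2 : S = l * Y := by
    rw [hS, Fintype.sum_prod_type_right, hY, Finset.mul_sum]
    refine Finset.sum_congr rfl fun j _ => ?_
    rw [show l * y j ^ 2 = y j * (l * y j) by ring, ← h2, Finset.mul_sum]
    exact Finset.sum_congr rfl fun i _ => by ring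
  have hXY : X = Y := mul_left_cancel₀ hl (e1.symm.trans e2)
  have hXpos : 0 < X := by linarith
  have cs : S ^ 2 ≤ (∑ p : R × C, b p.1 p.2 * (x p.1 ^ 2 / a p.1)) *
      (∑ p : R × C, b p.1 p.2 * (y p.2 ^ 2 / c p.2)) := by
    apply Finset.sum_sq_le_sum_mul_sum_of_sq_le_mul
    · intro p _
      exact mul_nonneg (hb _ _) (div_nonneg (sq_nonneg _) (ha _).le)
    · intro p _
      exact mul_nonneg (hb _ _) (div_nonneg (sq_nonneg _) (hc _).le)
    · intro p _
      apply le_of_eq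
      simp only [mul_pow, inv_pow, Real.sq_sqrt (ha _).le, Real.sq_sqrt (hc _).le]
      ring
  have f1 : ∑ p : R × C, b p.1 p.2 * (x p.1 ^ 2 / a p.1) ≤ α * X := by
    rw [Fintype.sum_prod_type, hX, Finset.mul_sum]
    refine Finset.sum_le_sum fun i _ => ?_
    simp only
    rw [← Finset.sum_mul]
    calc _ = (∑ j, b i j) / a i * x i ^ 2 := by ring
      _ ≤ _ := mul_le_mul_of_nonneg_right (hα i) (sq_nonneg _)
  have f2 : ∑ p : R × C, b p.1 p.2 * (y p.2 ^ 2 / c p.2) ≤ β * Y := by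
    rw [Fintype.sum_prod_type_right, hY, Finset.mul_sum]
    refine Finset.sum_le_sum fun j _ => ?_
    simp only
    rw [← Finset.sum_mul]
    calc _ = (∑ i, b i j) / c j * y j ^ 2 := by ring
      _ ≤ _ := mul_le_mul_of_nonneg_right (hβ j) (sq_nonneg _)
  have g : S ^ 2 ≤ (α * X) * (β * Y) := cs.trans (mul_le_mul f1 f2
    (Finset.sum_nonneg fun p _ => mul_nonneg (hb _ _) (div_nonneg (sq_nonneg _) (hc _).le))
    (mul_nonneg hα0 hXpos.le))
  rw [e1, ← hXY] at g
  have : l ^ 2 * X ^ 2 ≤ α * β * X ^ 2 := by nlinarith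
  exact le_of_mul_le_mul_right this (by positivity)

lemma aux_sup {R : Type*} [Fintype R] [Nonempty R] (w : R → ℝ) (hw : ∀ i, 0 ≤ w i) (s : ℝ)
    (hs : 0 < s) : 0 ≤ (⨆ i, w i / (w i + s)) ∧ (⨆ i, w i / (w i + s)) < 1 ∧
      ∀ i, w i / (w i + s) ≤ ⨆ i, w i / (w i + s) := by
  refine ⟨Real.iSup_nonneg fun i => div_nonneg (hw i) (by linarith [hw i]), ?_,
    fun i => le_ciSup (f := fun i => w i / (w i + s)) (Set.finite_range _).bddAbove i⟩
  obtain ⟨i, hi⟩ := exists_eq_ciSup_of_finite (f := fun i => w i / (w i + s))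
  rw [← hi, div_lt_one (by linarith [hw i])]
  linarith

/-- With `Z ∈ {0,1}^{R×C}`, weights `W_{ij} ≥ 0` positive on the support of
`Z`, row sums `W_{i·}` and column sums `W_{·j}` (every row and column of `Z` containing a
1), `A = diag(W_{i·} + σ_A^{-2})`, `C̃ = diag(W_{·j} + σ_B^{-2})`, `B = (Z_{ij}W_{ij})`,
and `B* = A^{-1/2} B C̃^{-1/2}`, the spectral radius `ρ` of `[[0, B*],[B*ᵀ, 0]]` satisfies
`ρ ≤ (max_i W_{i·}/(W_{i·}+σ_A^{-2}))^{1/2} (max_j W_{·j}/(W_{·j}+σ_B^{-2}))^{1/2} < 1`. -/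
theorem stmt2 {R C : Type*} [Fintype R] [Fintype C] [DecidableEq R] [DecidableEq C]
    [Nonempty R] [Nonempty C]
    (Z : R → C → ℝ) (hZ : ∀ i j, Z i j = 0 ∨ Z i j = 1)
    (W : R → C → ℝ) (hW0 : ∀ i j, 0 ≤ W i j) (hWpos : ∀ i j, Z i j = 1 → 0 < W i j)
    (hrow : ∀ i, ∃ j, Z i j = 1) (hcol : ∀ j, ∃ i, Z i j = 1)
    (σA σB : ℝ) (hσA : 0 < σA) (hσB : 0 < σB)
    (Wr : R → ℝ) (hWr : ∀ i, Wr i = ∑ j, Z i j * W i j)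
    (Wc : C → ℝ) (hWc : ∀ j, Wc j = ∑ i, Z i j * W i j)
    (Bs : Matrix R C ℝ)
    (hBs : ∀ i j, Bs i j = (Real.sqrt (Wr i + (σA ^ 2)⁻¹))⁻¹ * (Z i j * W i j) *
      (Real.sqrt (Wc j + (σB ^ 2)⁻¹))⁻¹)
    (hE : (Matrix.fromBlocks 0 Bs Bsᵀ (0 : Matrix C C ℝ)).IsHermitian)
    (ρ : ℝ) (hρ : ρ = ⨆ q, |hE.eigenvalues q|) :
    ρ ≤ Real.sqrt (⨆ i, Wr i / (Wr i + (σA ^ 2)⁻¹)) *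
        Real.sqrt (⨆ j, Wc j / (Wc j + (σB ^ 2)⁻¹)) ∧
    Real.sqrt (⨆ i, Wr i / (Wr i + (σA ^ 2)⁻¹)) *
        Real.sqrt (⨆ j, Wc j / (Wc j + (σB ^ 2)⁻¹)) < 1 := by
  have hb : ∀ i j, 0 ≤ Z i j * W i j := fun i j => by
    rcases hZ i j with h | h <;> simp [h, hW0 i j]
  have hr0 : ∀ i, 0 ≤ Wr i := fun i => by
    rw [hWr]; exact Finset.sum_nonneg fun j _ => hb i j
  have hc0 : ∀ j, 0 ≤ Wc j := fun j => by
    rw [hWc]; exact Finset.sum_nonneg fun i _ => hb i j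
  have hsA : 0 < (σA ^ 2)⁻¹ := by positivity
  have hsB : 0 < (σB ^ 2)⁻¹ := by positivity
  obtain ⟨a0, a1, a2⟩ := aux_sup Wr hr0 _ hsA
  obtain ⟨b0, b1, b2⟩ := aux_sup Wc hc0 _ hsB
  constructor
  · rw [hρ]
    refine ciSup_le fun q => ?_
    have hv := hE.mulVec_eigenvectorBasis q
    have hn : ‖hE.eigenvectorBasis q‖ = 1 := hE.eigenvectorBasis.orthonormal.1 q
    generalize hE.eigenvectorBasis q = v at hv hn
    refine aux_eig (fun i j => Z i j * W i j) hb (fun i => Wr i + (σA ^ 2)⁻¹)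
      (fun j => Wc j + (σB ^ 2)⁻¹) (fun i => by linarith [hr0 i]) (fun j => by linarith [hc0 j])
      _ _ a0 b0 (fun i => by simpa only [← hWr] using a2 i)
      (fun j => by simpa only [← hWc] using b2 j)
      (fun i => v (Sum.inl i)) (fun j => v (Sum.inr j)) _ ?_ ?_ ?_
    · intro i
      have := congrFun hv (Sum.inl i)
      simpa [Matrix.mulVec, dotProduct, Fintype.sum_sum_type, hBs] using this
    · intro j
      have := congrFun hv (Sum.inr j)
      simpa [Matrix.mulVec, dotProduct, Fintype.sum_sum_type, hBs] using this
    · rw [EuclideanSpace.norm_eq, Real.sqrt_eq_one] at hn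
      simp only [Fintype.sum_sum_type, Real.norm_eq_abs, sq_abs] at hn
      rw [hn]; exact one_pos
  · have h1 : Real.sqrt (⨆ i, Wr i / (Wr i + (σA ^ 2)⁻¹)) < 1 := by
      rw [Real.sqrt_lt' one_pos]; simpa using a1
    have h2 : Real.sqrt (⨆ j, Wc j / (Wc j + (σB ^ 2)⁻¹)) < 1 := by
      rw [Real.sqrt_lt' one_pos]; simpa using b1
    exact mul_lt_one_of_nonneg_of_lt_one_left (Real.sqrt_nonneg _) h1 h2.le
end

section
/- Let R, C ≥ 1, let Z ∈ {0,1}^{R×C}, and let W_{ij} ≥ 0 be weights with W_{ij} > 0 whenever Z_{ij} = 1. Define W_{i·} = Σ_j Z_{ij} W_{ij} and W_{·j} = Σ_i Z_{ij} W_{ij}. For σ_A, σ_B > 0 let A = diag(W_{i·} + σ_A^{-2}), C̃ = diag(W_{·j} + σ_B^{-2}), let B have entries Z_{ij} W_{ij}, and let B* = A^{-1/2} B C̃^{-1/2}. Then the largest eigenvalue λ₁ of B* B*ᵀ satisfies λ₁ ≤ (max_i W_{i·}/(W_{i·} + σ_A^{-2})) · (max_j W_{·j}/(W_{·j} + σ_B^{-2}));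 in particular, if max_i W_{i·} ≤ c_A and max_j W_{·j} ≤ c_B for constants c_A, c_B > 0, then λ₁ ≤ (1 + σ_A^{-2}/c_A)^{-1} (1 + σ_B^{-2}/c_B)^{-1}. -/
open Matrix

theorem aux_quad {R C : Type*} [Fintype R] [Fintype C]
    (b : R → C → ℝ) (hb : ∀ i j, 0 ≤ b i j)
    (a : R → ℝ) (c : C → ℝ) (ha : ∀ i, 0 < a i) (hc : ∀ j, 0 < c j)
    (qA qB : ℝ) (hqB : 0 ≤ qB)
    (hA : ∀ i, (∑ j, b i j) / a i ≤ qA) (hB : ∀ j, (∑ i, b i j) / c j ≤ qB) (v : R → ℝ) :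
    ∑ j, (∑ i, (Real.sqrt (a i))⁻¹ * b i j * (Real.sqrt (c j))⁻¹ * v i) ^ 2
      ≤ qA * qB * ∑ i, v i ^ 2 := by
  have h1 : ∀ j, (∑ i, (Real.sqrt (a i))⁻¹ * b i j * (Real.sqrt (c j))⁻¹ * v i) ^ 2
      ≤ qB * ∑ i, b i j * (v i ^ 2 / a i) := by
    intro j
    have hcs : (∑ i, (Real.sqrt (a i))⁻¹ * b i j * (Real.sqrt (c j))⁻¹ * v i) ^ 2
        ≤ (∑ i, b i j / c j) * ∑ i, b i j * (v i ^ 2 / a i) := by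
      apply Finset.sum_sq_le_sum_mul_sum_of_sq_eq_mul
      · intro i _
        exact div_nonneg (hb i j) (hc j).le
      · intro i _
        exact mul_nonneg (hb i j) (div_nonneg (sq_nonneg _) (ha i).le)
      · intro i _
        simp only [mul_pow, inv_pow, Real.sq_sqrt (ha i).le, Real.sq_sqrt (hc j).le]
        ring
    refine hcs.trans ?_
    rw [← Finset.sum_div]
    exact mul_le_mul_of_nonneg_right (hB j) (Finset.sum_nonneg fun i _ =>
      mul_nonneg (hb i j) (div_nonneg (sq_nonneg _) (ha i).le))
  calc _ ≤ ∑ j, qB * ∑ i, b i j * (v i ^ 2 / a i) := Finset.sum_le_sum fun j _ => h1 j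
    _ = qB * ∑ i, ((∑ j, b i j) / a i) * v i ^ 2 := by
      rw [← Finset.mul_sum, Finset.sum_comm]
      congr 1
      refine Finset.sum_congr rfl fun i _ => ?_
      rw [← Finset.sum_mul]
      ring
    _ ≤ qB * ∑ i, qA * v i ^ 2 := by
      refine mul_le_mul_of_nonneg_left (Finset.sum_le_sum fun i _ => ?_) hqB
      exact mul_le_mul_of_nonneg_right (hA i) (sq_nonneg _)
    _ = _ := by rw [← Finset.mul_sum]; ring

theorem aux_eig_s3 {R C : Type*} [Fintype R] [Fintype C] [DecidableEq R]
    (Bs : Matrix R C ℝ) (hM : (Bs * Bsᵀ).IsHermitian) (q : ℝ)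
    (h : ∀ v : R → ℝ, ∑ j, (∑ i, Bs i j * v i) ^ 2 ≤ q * ∑ i, v i ^ 2) (k : R) :
    hM.eigenvalues k ≤ q := by
  set v : R → ℝ := ⇑(hM.eigenvectorBasis k) with hv
  have hn : ∑ i, v i ^ 2 = 1 := by
    have h1 := hM.eigenvectorBasis.orthonormal.1 k
    have h2 := EuclideanSpace.real_norm_sq_eq (hM.eigenvectorBasis k)
    rw [h1] at h2
    rw [hv, ← h2]; norm_num
  have he : (Bs * Bsᵀ) *ᵥ v = hM.eigenvalues k • v := hM.mulVec_eigenvectorBasis k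
  have h3 : v ⬝ᵥ ((Bs * Bsᵀ) *ᵥ v) = ∑ j, (∑ i, Bs i j * v i) ^ 2 := by
    rw [← Matrix.mulVec_mulVec, Matrix.dotProduct_mulVec, ← Matrix.mulVec_transpose]
    simp only [dotProduct, mulVec, transpose_apply, sq]
  have h4 : v ⬝ᵥ (hM.eigenvalues k • v) = hM.eigenvalues k := by
    rw [dotProduct_smul]
    have : v ⬝ᵥ v = 1 := by rw [← hn]; simp only [dotProduct, sq]
    rw [this]; simp
  rw [he, h4] at h3
  have := h v
  rw [hn, ← h3] at this
  linarith

/-- Same setup as in the spectral radius bound (now without requiring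
nonempty rows/columns): with `A = diag(W_{i·} + σ_A^{-2})`, `C̃ = diag(W_{·j} + σ_B^{-2})`,
`B = (Z_{ij}W_{ij})`, `B* = A^{-1/2} B C̃^{-1/2}`, the largest eigenvalue `λ₁` of `B* B*ᵀ`
satisfies `λ₁ ≤ (max_i W_{i·}/(W_{i·}+σ_A^{-2})) (max_j W_{·j}/(W_{·j}+σ_B^{-2}))`;
in particular if `max_i W_{i·} ≤ c_A` and `max_j W_{·j} ≤ c_B` for `c_A, c_B > 0` then
`λ₁ ≤ (1 + σ_A^{-2}/c_A)⁻¹ (1 + σ_B^{-2}/c_B)⁻¹`. -/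
theorem stmt3 {R C : Type*} [Fintype R] [Fintype C] [DecidableEq R] [DecidableEq C]
    [Nonempty R] [Nonempty C]
    (Z : R → C → ℝ) (hZ : ∀ i j, Z i j = 0 ∨ Z i j = 1)
    (W : R → C → ℝ) (hW0 : ∀ i j, 0 ≤ W i j) (hWpos : ∀ i j, Z i j = 1 → 0 < W i j)
    (σA σB : ℝ) (hσA : 0 < σA) (hσB : 0 < σB)
    (Wr : R → ℝ) (hWr : ∀ i, Wr i = ∑ j, Z i j * W i j)
    (Wc : C → ℝ) (hWc : ∀ j, Wc j = ∑ i, Z i j * W i j)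
    (Bs : Matrix R C ℝ)
    (hBs : ∀ i j, Bs i j = (Real.sqrt (Wr i + (σA ^ 2)⁻¹))⁻¹ * (Z i j * W i j) *
      (Real.sqrt (Wc j + (σB ^ 2)⁻¹))⁻¹)
    (hM : (Bs * Bsᵀ).IsHermitian)
    (lam1 : ℝ) (hlam1 : lam1 = ⨆ i, hM.eigenvalues i) :
    lam1 ≤ (⨆ i, Wr i / (Wr i + (σA ^ 2)⁻¹)) * (⨆ j, Wc j / (Wc j + (σB ^ 2)⁻¹)) ∧
    ∀ cA cB : ℝ, 0 < cA → 0 < cB → (∀ i, Wr i ≤ cA) → (∀ j, Wc j ≤ cB) →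
      lam1 ≤ (1 + (σA ^ 2)⁻¹ / cA)⁻¹ * (1 + (σB ^ 2)⁻¹ / cB)⁻¹ := by
  have hb : ∀ i j, 0 ≤ Z i j * W i j := by
    intro i j
    rcases hZ i j with h | h <;> rw [h] <;> simp [hW0 i j]
  have hsA : 0 < (σA ^ 2)⁻¹ := by positivity
  have hsB : 0 < (σB ^ 2)⁻¹ := by positivity
  have hr0 : ∀ i, 0 ≤ Wr i := fun i => by
    rw [hWr]; exact Finset.sum_nonneg fun j _ => hb i j
  have hc0 : ∀ j, 0 ≤ Wc j := fun j => by
    rw [hWc]; exact Finset.sum_nonneg fun i _ => hb i j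
  have key : ∀ qA qB : ℝ, 0 ≤ qB → (∀ i, Wr i / (Wr i + (σA ^ 2)⁻¹) ≤ qA) →
      (∀ j, Wc j / (Wc j + (σB ^ 2)⁻¹) ≤ qB) → lam1 ≤ qA * qB := by
    intro qA qB hqB hA hB
    rw [hlam1]
    refine ciSup_le fun k => aux_eig_s3 Bs hM _ (fun v => ?_) k
    simp only [hBs]
    refine aux_quad (fun i j => Z i j * W i j) hb (fun i => Wr i + (σA ^ 2)⁻¹)
      (fun j => Wc j + (σB ^ 2)⁻¹) (fun i => by have := hr0 i; positivity)
      (fun j => by have := hc0 j; positivity) qA qB hqB ?_ ?_ v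
    · intro i
      have := hA i
      simp only [← hWr]
      exact this
    · intro j
      have := hB j
      simp only [← hWc]
      exact this
  have mono : ∀ w c s : ℝ, 0 ≤ w → 0 < c → 0 < s → w ≤ c → w / (w + s) ≤ (1 + s / c)⁻¹ := by
    intro w c s hw hc hs hwc
    have : (1 + s / c)⁻¹ = c / (c + s) := by field_simp
    rw [this, div_le_div_iff₀ (by positivity) (by positivity)]
    nlinarith
  constructor
  · refine key _ _ ?_ (fun i => le_ciSup (f := fun i => Wr i / (Wr i + (σA ^ 2)⁻¹))
      (Set.finite_range _).bddAbove i) (fun j => le_ciSup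
      (f := fun j => Wc j / (Wc j + (σB ^ 2)⁻¹)) (Set.finite_range _).bddAbove j)
    exact Real.iSup_nonneg fun j => div_nonneg (hc0 j) (by have := hc0 j; positivity)
  · intro cA cB hcA hcB h1 h2
    exact key _ _ (by positivity) (fun i => mono _ _ _ (hr0 i) hcA hsA (h1 i))
      (fun j => mono _ _ _ (hc0 j) hcB hsB (h2 j))
end

section
/- Let N, R, p ≥ 1, let W ∈ ℝ^{N×N} be a diagonal matrix with positive diagonal entries, let z ∈ ℝ^N, let X ∈ ℝ^{N×p}, and let Z_A ∈ {0,1}^{N×R} be a matrix each of whose rows has exactly one entry equal to 1 (an incidence matrix of group membership). Suppose column q of X equals the sum of k ≥ 1 distinct columns i₁, …, i_k of Z_A, and let σ_A^{-2} > 0. Then any minimizer (β̂, â) ∈ ℝ^p × ℝ^R of the penalized weighted least squares objective f(β, a) = (z − Xβ − Z_A a)ᵀ W (z − Xβ − Z_A a) + σ_A^{-2} ‖a‖² satisfies Σ_{ℓ=1}^{k} â_{i_ℓ} = 0. -/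
open Matrix

/-- In the single-factor penalized weighted least squares problem
`f(β,a) = (z − Xβ − Z_A a)ᵀ W (z − Xβ − Z_A a) + σ_A^{-2} ‖a‖²`, if column `q` of `X`
equals the sum of `k ≥ 1` distinct columns `i₁,…,i_k` of the incidence matrix `Z_A`
(each row of `Z_A` has exactly one entry equal to 1, all entries in `{0,1}`), and the
ridge parameter `c = σ_A^{-2}` is positive, then any minimizer `(β̂, â)` satisfies
`Σ_{ℓ=1}^k â_{i_ℓ} = 0`. -/
theorem stmt7 {N R p : ℕ} (hN : 1 ≤ N) (hR : 1 ≤ R) (hp : 1 ≤ p)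
    (w : Fin N → ℝ) (hw : ∀ n, 0 < w n)
    (z : Fin N → ℝ) (X : Matrix (Fin N) (Fin p) ℝ)
    (ZA : Matrix (Fin N) (Fin R) ℝ)
    (hZA01 : ∀ n r, ZA n r = 0 ∨ ZA n r = 1)
    (hZArow : ∀ n, ∃! r, ZA n r = 1)
    (q : Fin p) (k : ℕ) (hk : 1 ≤ k)
    (ι : Fin k → Fin R) (hι : Function.Injective ι)
    (hcol : ∀ n, X n q = ∑ l, ZA n (ι l))
    (c : ℝ) (hc : 0 < c)
    (βhat : Fin p → ℝ) (ahat : Fin R → ℝ)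
    (hmin : ∀ (β : Fin p → ℝ) (a : Fin R → ℝ),
      (∑ n, w n * (z n - X.mulVec βhat n - ZA.mulVec ahat n) ^ 2) + c * ∑ r, ahat r ^ 2 ≤
      (∑ n, w n * (z n - X.mulVec β n - ZA.mulVec a n) ^ 2) + c * ∑ r, a r ^ 2) :
    ∑ l, ahat (ι l) = 0 := by
  obtain ⟨v, hv⟩ : ∃ v : Fin R → ℝ, v = ∑ l, Pi.single (ι l) (1 : ℝ) := ⟨_, rfl⟩
  have hdot : ∀ u : Fin R → ℝ, u ⬝ᵥ v = ∑ l, u (ι l) := by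
    intro u
    rw [hv, dotProduct_sum]
    simp
  have hS : ∑ r, ahat r * v r = ∑ l, ahat (ι l) := hdot ahat
  have hZv : ∀ n, ZA.mulVec v n = X n q := by
    intro n
    rw [hcol n]
    exact hdot (ZA n)
  rw [← hS]
  obtain ⟨S, hSd⟩ : ∃ S, S = ∑ r, ahat r * v r := ⟨_, rfl⟩
  obtain ⟨V, hVd⟩ : ∃ V, V = ∑ r, v r ^ 2 := ⟨_, rfl⟩
  have hV : 0 ≤ V := by rw [hVd]; positivity
  have key : ∀ t : ℝ, 2 * t * S ≤ t ^ 2 * V := by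
    intro t
    have h := hmin (βhat + t • Pi.single q 1) (ahat - t • v)
    have hfit : ∀ n, z n - X.mulVec (βhat + t • Pi.single q 1) n - ZA.mulVec (ahat - t • v) n
        = z n - X.mulVec βhat n - ZA.mulVec ahat n := by
      intro n
      rw [Matrix.mulVec_add, Matrix.mulVec_sub, Matrix.mulVec_smul, Matrix.mulVec_smul]
      simp only [Pi.add_apply, Pi.sub_apply, Pi.smul_apply, hZv, Matrix.mulVec_single_one,
        Matrix.col_apply, smul_eq_mul]
      ring
    simp only [hfit] at h
    have h2 := le_of_mul_le_mul_left (le_of_add_le_add_left h) hc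
    have h3 : ∑ r, (ahat - t • v) r ^ 2 = ∑ r, ahat r ^ 2 - 2 * t * S + t ^ 2 * V := by
      rw [hSd, hVd, Finset.mul_sum, Finset.mul_sum, ← Finset.sum_sub_distrib,
        ← Finset.sum_add_distrib]
      refine Finset.sum_congr rfl fun r _ => ?_
      simp only [Pi.sub_apply, Pi.smul_apply, smul_eq_mul]
      ring
    linarith
  rw [← hSd]
  have h := key (S / (V + 1))
  have hp1 : 0 < V + 1 := by linarith
  have h4 : 2 * S ^ 2 * (V + 1) ≤ S ^ 2 * V := by
    have h5 := mul_le_mul_of_nonneg_right h (sq_nonneg (V + 1))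
    field_simp at h5
    nlinarith
  have : S ^ 2 = 0 := by nlinarith [sq_nonneg S, mul_nonneg (sq_nonneg S) hV]
  exact pow_eq_zero_iff (two_ne_zero) |>.mp this
end

section
/- Let N, R, C, p ≥ 1, let X ∈ ℝ^{N×p} have full column rank, let Z_A ∈ {0,1}^{N×R} and Z_B ∈ {0,1}^{N×C} be incidence matrices (each row of each has exactly one entry equal to 1), let W ∈ ℝ^{N×N} be diagonal with positive diagonal entries, let z ∈ ℝ^N, and let 0 < σ_A², σ_B² < ∞. Define pl(β, a, b) = (z − Xβ − Z_A a − Z_B b)ᵀ W (z − Xβ − Z_A a − Z_B b) + σ_A^{-2}‖a‖² + σ_B^{-2}‖b‖². Starting from any (β⁽⁰⁾, a⁽⁰⁾, b⁽⁰⁾), define iterates by: (β⁽ᵏ⁺¹ᐟ²⁾, a⁽ᵏ⁺¹⁾) = argmin over (β, a) of pl(β, a, b⁽ᵏ⁾), and (β⁽ᵏ⁺¹⁾, b⁽ᵏ⁺¹⁾) = argmin over (β, b) of pl(β, a⁽ᵏ⁺¹⁾, b) (both argmins exist and are unique). Then the sequence (β⁽ᵏ⁾, a⁽ᵏ⁾,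 b⁽ᵏ⁾) converges as k → ∞ to the unique global minimizer of pl. -/
open Matrix Filter

/-- The penalized weighted least squares objective
`pl(β,a,b) = (z − Xβ − Z_A a − Z_B b)ᵀ W (z − Xβ − Z_A a − Z_B b)
  + σ_A^{-2}‖a‖² + σ_B^{-2}‖b‖²` with diagonal weight matrix `W = diag w`. -/
noncomputable def pl8 {N R C p : ℕ} (X : Matrix (Fin N) (Fin p) ℝ)
    (ZA : Matrix (Fin N) (Fin R) ℝ) (ZB : Matrix (Fin N) (Fin C) ℝ)
    (w z : Fin N → ℝ) (sA2 sB2 : ℝ)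
    (β : Fin p → ℝ) (a : Fin R → ℝ) (b : Fin C → ℝ) : ℝ :=
  (∑ nn, w nn * (z nn - X.mulVec β nn - ZA.mulVec a nn - ZB.mulVec b nn) ^ 2)
    + sA2⁻¹ * ∑ r, a r ^ 2 + sB2⁻¹ * ∑ j, b j ^ 2

lemma orth8 {H : Type*} [NormedAddCommGroup H] [InnerProductSpace ℝ H] (u h : H)
    (hm : ∀ c : ℝ, ‖u‖ ^ 2 ≤ ‖u + c • h‖ ^ 2) : inner ℝ u h = 0 := by
  set i := inner ℝ u h with hi
  have hq : 0 ≤ ‖h‖ ^ 2 := by positivity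
  set q := ‖h‖ ^ 2 with hqd
  have key : ∀ c : ℝ, 0 ≤ 2 * (c * i) + c ^ 2 * q := by
    intro c
    have h1 := hm c
    rw [norm_add_sq_real, inner_smul_right, norm_smul, mul_pow, Real.norm_eq_abs, sq_abs] at h1
    linarith
  have h2 := key (-i / (q + 1))
  have h3 : 2 * (-i / (q + 1) * i) + (-i / (q + 1)) ^ 2 * q = -(i ^ 2 * (q + 2)) / (q + 1) ^ 2 := by
    field_simp
    ring
  rw [h3] at h2
  have h4 : 0 < (q + 1) ^ 2 := by positivity
  have h5 : 0 ≤ -(i ^ 2 * (q + 2)) := by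
    by_contra hc
    exact absurd h2 (not_le.mpr (div_neg_of_neg_of_pos (not_le.mp hc) h4))
  have h6 : i ^ 2 = 0 := by nlinarith [sq_nonneg i]
  exact pow_eq_zero_iff (two_ne_zero) |>.mp h6

lemma abstract8 {P A B H : Type*}
    [NormedAddCommGroup P] [NormedSpace ℝ P] [FiniteDimensional ℝ P]
    [NormedAddCommGroup A] [NormedSpace ℝ A] [FiniteDimensional ℝ A]
    [NormedAddCommGroup B] [NormedSpace ℝ B] [FiniteDimensional ℝ B]
    [NormedAddCommGroup H] [InnerProductSpace ℝ H] [FiniteDimensional ℝ H]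
    (L : (P × A × B) →ₗ[ℝ] H) (hL : Function.Injective L) (t : H)
    (f : P → A → B → ℝ) (hf : ∀ x a b, f x a b = ‖L (x, a, b) - t‖ ^ 2)
    (βf βh : ℕ → P) (a : ℕ → A) (b : ℕ → B)
    (hstep1 : ∀ k, ∀ β' a', f (βh k) (a (k + 1)) (b k) ≤ f β' a' (b k))
    (hstep2 : ∀ k, ∀ β' b', f (βf (k + 1)) (a (k + 1)) (b (k + 1)) ≤ f β' (a (k + 1)) b') :
    ∃ m : P × A × B, (∀ β' a' b', f m.1 m.2.1 m.2.2 ≤ f β' a' b') ∧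
      (∀ β' a' b', (∀ β'' a'' b'', f β' a' b' ≤ f β'' a'' b'') → (β', a', b') = m) ∧
      Tendsto (fun k => (βf k, a k, b k)) atTop (nhds m) := by
  obtain ⟨m, hm⟩ : ∃ m, L m = (LinearMap.range L).starProjection t :=
    (LinearMap.range L).starProjection_apply_mem t
  have hmo : ∀ v, inner ℝ (L m - t) (L v) = 0 := by
    intro v
    have := (LinearMap.range L).starProjection_inner_eq_zero t (L v) ⟨v, rfl⟩
    rw [← hm] at this
    rw [← neg_sub, inner_neg_left, this, neg_zero]
  have hmf : ∀ v, ‖L v - t‖ ^ 2 = ‖L m - t‖ ^ 2 + ‖L (v - m)‖ ^ 2 := by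
    intro v
    have : L v - t = (L m - t) + L (v - m) := by rw [map_sub]; abel
    rw [this, norm_add_sq_real, hmo]; ring
  obtain ⟨K, hK0, hK⟩ := LinearMap.exists_antilipschitzWith L (LinearMap.ker_eq_bot.mpr hL)
  have hKb : ∀ v, ‖v‖ ≤ K * ‖L v‖ := by
    intro v
    have := hK.le_mul_dist v 0
    simpa [dist_eq_norm] using this
  obtain ⟨M, hM0, hM⟩ : ∃ M : ℝ, 0 ≤ M ∧ ∀ v, ‖L v‖ ≤ M * ‖v‖ :=
    ⟨‖LinearMap.toContinuousLinearMap L‖, norm_nonneg _,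
      fun v => (LinearMap.toContinuousLinearMap L).le_opNorm v⟩
  refine ⟨m, ?_, ?_, ?_⟩
  · intro β' a' b'
    rw [hf, hf, hmf (β', a', b')]
    exact le_add_of_nonneg_right (by positivity)
  · intro β' a' b' h
    have h1 := h m.1 m.2.1 m.2.2
    rw [hf, hf, hmf (β', a', b')] at h1
    have h2 : ‖L ((β', a', b') - m)‖ ^ 2 = 0 := by
      have : (0:ℝ) ≤ ‖L ((β', a', b') - m)‖ ^ 2 := by positivity
      have h3 : ((m.1, m.2.1, m.2.2) : P × A × B) = m := rfl
      rw [h3] at h1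
      linarith
    have h3 : L ((β', a', b') - m) = 0 := by simpa using h2
    have h4 := hL (h3.trans (map_zero L).symm)
    exact sub_eq_zero.mp h4
  · rw [← tendsto_add_atTop_iff_nat 1]
    set x : ℕ → P × A × B := fun k => (βf (k+1), a (k+1), b (k+1)) with hx
    set y : ℕ → P × A × B := fun k => (βh (k+1), a (k+2), b (k+1)) with hy
    have hyo : ∀ k (p : P) (r : A), inner ℝ (L (y k) - t) (L (p, r, 0)) = 0 := by
      intro k p r
      apply orth8
      intro c
      have h1 := hstep1 (k+1) (βh (k+1) + c • p) (a (k+2) + c • r)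
      rw [hf, hf] at h1
      have : L (y k) - t + c • L (p, r, 0) =
          L (βh (k+1) + c • p, a (k+2) + c • r, b (k+1)) - t := by
        rw [← map_smul, sub_add_eq_add_sub, ← map_add]
        simp [hy]
      rw [this]; exact h1
    have hxo : ∀ k (p : P) (r : B), inner ℝ (L (x k) - t) (L (p, 0, r)) = 0 := by
      intro k p r
      apply orth8
      intro c
      have h1 := hstep2 k (βf (k+1) + c • p) (b (k+1) + c • r)
      rw [hf, hf] at h1
      have : L (x k) - t + c • L (p, 0, r) =
          L (βf (k+1) + c • p, a (k+1), b (k+1) + c • r) - t := by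
        rw [← map_smul, sub_add_eq_add_sub, ← map_add]
        simp [hx]
      rw [this]; exact h1
    set F : ℕ → ℝ := fun k => ‖L (x k) - t‖ ^ 2 with hF
    have hdec : ∀ k, ‖L (x k - y k)‖ ^ 2 ≤ F k - F (k+1) := by
      intro k
      have h1 : F (k+1) ≤ ‖L (y k) - t‖ ^ 2 := by
        have := hstep2 (k+1) (βh (k+1)) (b (k+1))
        rw [hf, hf] at this
        exact this
      have h2 : F k = ‖L (y k) - t‖ ^ 2 + ‖L (x k - y k)‖ ^ 2 := by
        have e : L (x k) - t = (L (y k) - t) + L (x k - y k) := by rw [map_sub]; abel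
        have e2 : x k - y k = (βf (k+1) - βh (k+1), a (k+1) - a (k+2), 0) := by
          simp [hx, hy]
        have := hyo k (βf (k+1) - βh (k+1)) (a (k+1) - a (k+2))
        rw [← e2] at this
        simp only [hF]
        rw [e, norm_add_sq_real, this]; ring
      linarith
    have hanti : Antitone F := antitone_nat_of_succ_le fun k => by
      have := hdec k
      have h0 : (0:ℝ) ≤ ‖L (x k - y k)‖ ^ 2 := by positivity
      linarith
    have hlim : Tendsto F atTop (nhds (⨅ i, F i)) :=
      tendsto_atTop_ciInf hanti ⟨0, by rintro _ ⟨k, rfl⟩; simp only [hF]; positivity⟩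
    have hdiff : Tendsto (fun k => F k - F (k+1)) atTop (nhds 0) := by
      have := hlim.sub ((tendsto_add_atTop_iff_nat 1).mpr hlim)
      simpa using this
    have hsq : Tendsto (fun k => ‖L (x k - y k)‖ ^ 2) atTop (nhds 0) :=
      squeeze_zero (fun k => by positivity) hdec hdiff
    have hnorm : Tendsto (fun k => ‖L (x k - y k)‖) atTop (nhds 0) := by
      have := hsq.sqrt
      simpa [Real.sqrt_sq] using this
    have hbound : ∀ k, ‖x k - m‖ ≤ K * (M * K * ‖L (x k - y k)‖) := by
      intro k
      refine (hKb _).trans (mul_le_mul_of_nonneg_left ?_ K.2)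
      set s : P × A × B := (0, a (k+1) - m.2.1, 0) with hs
      have hsn : ‖s‖ ≤ ‖x k - m‖ := by
        have e1 : ‖s‖ = ‖a (k+1) - m.2.1‖ := by simp [hs, Prod.norm_def]
        rw [e1]
        exact (norm_fst_le (x k - m).2).trans (norm_snd_le (x k - m))
      have hsL : ‖L s‖ ≤ M * K * ‖L (x k - m)‖ := by
        calc ‖L s‖ ≤ M * ‖s‖ := hM s
          _ ≤ M * (K * ‖L (x k - m)‖) := mul_le_mul_of_nonneg_left (hsn.trans (hKb _)) hM0
          _ = _ := by ring
      have e2 : x k - m = s + (βf (k+1) - m.1, 0, b (k+1) - m.2.2) := by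
        ext <;> simp [hx, hs]
      have hxm : ∀ v, inner ℝ (L (x k - m)) (L v) = inner ℝ (L (x k) - t) (L v) := by
        intro v
        have : L (x k - m) = (L (x k) - t) - (L m - t) := by rw [map_sub]; abel
        rw [this, inner_sub_left, hmo, sub_zero]
      have h1 : inner ℝ (L (x k - m)) (L (x k - m)) = inner ℝ (L (x k - y k)) (L s) := by
        rw [hxm]
        conv_lhs => rw [e2]
        rw [map_add, inner_add_right, hxo, add_zero]
        have : L (x k - y k) = (L (x k) - t) - (L (y k) - t) := by rw [map_sub]; abel
        rw [this, inner_sub_left (L (x k) - t), hyo, sub_zero]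
      have h2 : ‖L (x k - m)‖ * ‖L (x k - m)‖ ≤
          (M * K * ‖L (x k - y k)‖) * ‖L (x k - m)‖ := by
        rw [← real_inner_self_eq_norm_mul_norm, h1]
        calc _ ≤ ‖L (x k - y k)‖ * ‖L s‖ := real_inner_le_norm _ _
          _ ≤ ‖L (x k - y k)‖ * (M * K * ‖L (x k - m)‖) :=
            mul_le_mul_of_nonneg_left hsL (norm_nonneg _)
          _ = _ := by ring
      rcases (norm_nonneg (L (x k - m))).eq_or_lt with h0 | h0
      · rw [← h0]
        exact mul_nonneg (mul_nonneg hM0 K.2) (norm_nonneg _)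
      · exact le_of_mul_le_mul_right h2 h0
    rw [tendsto_iff_norm_sub_tendsto_zero]
    refine squeeze_zero (fun k => norm_nonneg _) hbound ?_
    have := (hnorm.const_mul (M * K)).const_mul (K:ℝ)
    simpa using this

noncomputable def lin8 {N R C p : ℕ} (X : Matrix (Fin N) (Fin p) ℝ)
    (ZA : Matrix (Fin N) (Fin R) ℝ) (ZB : Matrix (Fin N) (Fin C) ℝ)
    (w : Fin N → ℝ) (sA2 sB2 : ℝ) :
    ((Fin p → ℝ) × (Fin R → ℝ) × (Fin C → ℝ)) →ₗ[ℝ]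
      EuclideanSpace ℝ (Fin N ⊕ Fin R ⊕ Fin C) where
  toFun v := WithLp.toLp 2 (Sum.elim
    (fun n => √(w n) * (X.mulVec v.1 n + ZA.mulVec v.2.1 n + ZB.mulVec v.2.2 n))
    (Sum.elim (fun r => √(sA2⁻¹) * v.2.1 r) (fun c => √(sB2⁻¹) * v.2.2 c)))
  map_add' u v := by
    ext i
    rcases i with i | i | i <;> simp [Matrix.mulVec_add] <;> ring
  map_smul' c v := by
    ext i
    rcases i with i | i | i <;> simp [Matrix.mulVec_smul] <;> ring

/-- clubbed backfitting (block coordinate descent), alternating exact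
minimization of `pl` over `(β, a)` with `b` fixed and over `(β, b)` with `a` fixed,
converges from any starting point to the unique global minimizer of `pl`. -/
theorem stmt8 {N R C p : ℕ} (hN : 1 ≤ N) (hR : 1 ≤ R) (hC : 1 ≤ C) (hp : 1 ≤ p)
    (X : Matrix (Fin N) (Fin p) ℝ)
    (hX : LinearIndependent ℝ (fun j i => X i j))
    (ZA : Matrix (Fin N) (Fin R) ℝ) (ZB : Matrix (Fin N) (Fin C) ℝ)
    (hZA01 : ∀ n r, ZA n r = 0 ∨ ZA n r = 1) (hZArow : ∀ n, ∃! r, ZA n r = 1)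
    (hZB01 : ∀ n c, ZB n c = 0 ∨ ZB n c = 1) (hZBrow : ∀ n, ∃! c, ZB n c = 1)
    (w : Fin N → ℝ) (hw : ∀ n, 0 < w n) (z : Fin N → ℝ)
    (sA2 sB2 : ℝ) (hsA2 : 0 < sA2) (hsB2 : 0 < sB2)
    (βf βh : ℕ → Fin p → ℝ) (a : ℕ → Fin R → ℝ) (b : ℕ → Fin C → ℝ)
    (hstep1 : ∀ k, ∀ (β' : Fin p → ℝ) (a' : Fin R → ℝ),
      pl8 X ZA ZB w z sA2 sB2 (βh k) (a (k + 1)) (b k) ≤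
        pl8 X ZA ZB w z sA2 sB2 β' a' (b k))
    (hstep2 : ∀ k, ∀ (β' : Fin p → ℝ) (b' : Fin C → ℝ),
      pl8 X ZA ZB w z sA2 sB2 (βf (k + 1)) (a (k + 1)) (b (k + 1)) ≤
        pl8 X ZA ZB w z sA2 sB2 β' (a (k + 1)) b') :
    ∃ m : (Fin p → ℝ) × (Fin R → ℝ) × (Fin C → ℝ),
      (∀ (β' : Fin p → ℝ) (a' : Fin R → ℝ) (b' : Fin C → ℝ),
        pl8 X ZA ZB w z sA2 sB2 m.1 m.2.1 m.2.2 ≤ pl8 X ZA ZB w z sA2 sB2 β' a' b') ∧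
      (∀ (β' : Fin p → ℝ) (a' : Fin R → ℝ) (b' : Fin C → ℝ),
        (∀ (β'' : Fin p → ℝ) (a'' : Fin R → ℝ) (b'' : Fin C → ℝ),
          pl8 X ZA ZB w z sA2 sB2 β' a' b' ≤ pl8 X ZA ZB w z sA2 sB2 β'' a'' b'') →
        (β', a', b') = m) ∧
      Tendsto (fun k => (βf k, a k, b k)) atTop (nhds m) := by
  have hA : 0 ≤ sA2⁻¹ := by positivity
  have hB : 0 ≤ sB2⁻¹ := by positivity
  refine abstract8 (lin8 X ZA ZB w sA2 sB2) ?_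
    (WithLp.toLp 2 (Sum.elim (fun n => √(w n) * z n) (fun _ => 0)))
    (pl8 X ZA ZB w z sA2 sB2) ?_ βf βh a b hstep1 hstep2
  · rw [injective_iff_map_eq_zero]
    rintro ⟨x, r, c⟩ h
    have hr : r = 0 := by
      ext i
      have := congrArg (fun u => u.ofLp (Sum.inr (Sum.inl i))) h
      simpa [lin8, Real.sqrt_eq_zero', not_le.mpr hsA2] using this
    have hc : c = 0 := by
      ext i
      have := congrArg (fun u => u.ofLp (Sum.inr (Sum.inr i))) h
      simpa [lin8, Real.sqrt_eq_zero', not_le.mpr hsB2] using this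
    subst hr hc
    have hx : X.mulVec x = 0 := by
      ext i
      have := congrArg (fun u => u.ofLp (Sum.inl i)) h
      simpa [lin8, Real.sqrt_eq_zero', not_le.mpr (hw i)] using this
    have hx0 : x = 0 := by
      ext j
      refine Fintype.linearIndependent_iff.mp hX x ?_ j
      ext i
      have := congrFun hx i
      simp only [Matrix.mulVec, dotProduct] at this
      simpa [mul_comm] using this
    rw [hx0]; rfl
  · intro x r c
    rw [EuclideanSpace.real_norm_sq_eq, Fintype.sum_sum_type, Fintype.sum_sum_type]
    simp only [pl8, lin8, Finset.mul_sum, LinearMap.coe_mk, AddHom.coe_mk, PiLp.sub_apply,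
      Sum.elim_inl, Sum.elim_inr, sub_zero, mul_pow, Real.sq_sqrt hA, Real.sq_sqrt hB]
    rw [← add_assoc]
    congr 2
    refine Finset.sum_congr rfl fun n _ => ?_
    rw [← mul_sub, mul_pow, Real.sq_sqrt (hw n).le]
    ring
end

section
/- Let R, C ≥ 1, Z ∈ {0,1}^{R×C} with every row and column containing at least one 1, and suppose the weights satisfy 0 < w̲ ≤ W_{ij} ≤ ω̄ < ∞ for all (i,j) with Z_{ij} = 1. Define W_{i·} = Σ_j Z_{ij} W_{ij}, W_{·j} = Σ_i Z_{ij} W_{ij}, row counts N_{i·} = Σ_j Z_{ij}, column counts N_{·j} = Σ_i Z_{ij}, and for σ_A, σ_B > 0 let A = diag(W_{i·} + σ_A^{-2}), C̃ = diag(W_{·j} + σ_B^{-2}), B with entries Z_{ij} W_{ij}, and B* = A^{-1/2} B C̃^{-1/2}. Then tr(B* B*ᵀ) ≤ (ω̄/w̲)² · R / min_j N_{·j}. -/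
open Matrix

/-- With `Z ∈ {0,1}^{R×C}` (every row and column containing a 1) and
weights satisfying `0 < w̲ ≤ W_{ij} ≤ ω̄` whenever `Z_{ij} = 1`, with row/column weight
sums `W_{i·}`, `W_{·j}`, column counts `N_{·j} = Σ_i Z_{ij}`, `A = diag(W_{i·}+σ_A^{-2})`,
`C̃ = diag(W_{·j}+σ_B^{-2})`, `B = (Z_{ij}W_{ij})` and `B* = A^{-1/2} B C̃^{-1/2}`, we have
`tr(B* B*ᵀ) ≤ (ω̄/w̲)² · R / min_j N_{·j}`. -/
theorem stmt13 {R C : Type*} [Fintype R] [Fintype C] [DecidableEq R] [DecidableEq C]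
    [Nonempty R] [Nonempty C]
    (Z : R → C → ℝ) (hZ : ∀ i j, Z i j = 0 ∨ Z i j = 1)
    (W : R → C → ℝ)
    (wlow ωbar : ℝ) (hwlow : 0 < wlow)
    (hWbounds : ∀ i j, Z i j = 1 → wlow ≤ W i j ∧ W i j ≤ ωbar)
    (hrow : ∀ i, ∃ j, Z i j = 1) (hcol : ∀ j, ∃ i, Z i j = 1)
    (σA σB : ℝ) (hσA : 0 < σA) (hσB : 0 < σB)
    (Wr : R → ℝ) (hWr : ∀ i, Wr i = ∑ j, Z i j * W i j)
    (Wc : C → ℝ) (hWc : ∀ j, Wc j = ∑ i, Z i j * W i j)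
    (Bs : Matrix R C ℝ)
    (hBs : ∀ i j, Bs i j = (Real.sqrt (Wr i + (σA ^ 2)⁻¹))⁻¹ * (Z i j * W i j) *
      (Real.sqrt (Wc j + (σB ^ 2)⁻¹))⁻¹) :
    (Bs * Bsᵀ).trace ≤ (ωbar / wlow) ^ 2 * (Fintype.card R : ℝ) / ⨅ j, ∑ i, Z i j := by
  have hZ0 : ∀ i j, 0 ≤ Z i j := fun i j => by rcases hZ i j with h | h <;> simp [h]
  have hle : ∀ i j, wlow * Z i j ≤ Z i j * W i j := fun i j => by
    rcases hZ i j with h | h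
    · simp [h]
    · simpa [h] using (hWbounds i j h).1
  set m : ℝ := ⨅ j, ∑ i, Z i j with hm
  have hmle : ∀ j, m ≤ ∑ i, Z i j := fun j =>
    ciInf_le (Set.finite_range (fun j => ∑ i, Z i j)).bddBelow j
  have hmpos : 0 < m := by
    obtain ⟨j, hj⟩ := exists_eq_ciInf_of_finite (f := fun j => ∑ i, Z i j)
    rw [hm, ← hj]
    obtain ⟨i, hi⟩ := hcol j
    exact Finset.sum_pos' (fun i _ => hZ0 i j) ⟨i, Finset.mem_univ i, by rw [hi]; norm_num⟩
  have hNpos : ∀ i, 0 < ∑ j, Z i j := fun i => by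
    obtain ⟨j, hj⟩ := hrow i
    exact Finset.sum_pos' (fun j _ => hZ0 i j) ⟨j, Finset.mem_univ j, by rw [hj]; norm_num⟩
  have hA : ∀ i, wlow * ∑ j, Z i j ≤ Wr i + (σA ^ 2)⁻¹ := fun i => by
    have h1 : wlow * ∑ j, Z i j ≤ Wr i := by
      rw [hWr, Finset.mul_sum]
      exact Finset.sum_le_sum fun j _ => hle i j
    have h2 : 0 ≤ (σA ^ 2)⁻¹ := by positivity
    linarith
  have hC : ∀ j, wlow * m ≤ Wc j + (σB ^ 2)⁻¹ := fun j => by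
    have h1 : wlow * ∑ i, Z i j ≤ Wc j := by
      rw [hWc, Finset.mul_sum]
      exact Finset.sum_le_sum fun i _ => hle i j
    have h2 : 0 ≤ (σB ^ 2)⁻¹ := by positivity
    have h3 := mul_le_mul_of_nonneg_left (hmle j) hwlow.le
    linarith
  have key : ∀ i j, Bs i j * Bs i j ≤
      Z i j * (ωbar ^ 2 / ((wlow * ∑ j, Z i j) * (wlow * m))) := fun i j => by
    have p1 : 0 < wlow * ∑ j, Z i j := mul_pos hwlow (hNpos i)
    have p2 : 0 < wlow * m := mul_pos hwlow hmpos
    have q1 := p1.trans_le (hA i)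
    have q2 := p2.trans_le (hC j)
    have e : Bs i j * Bs i j =
        (Z i j * W i j) ^ 2 / ((Wr i + (σA ^ 2)⁻¹) * (Wc j + (σB ^ 2)⁻¹)) := by
      have s1 := Real.sq_sqrt q1.le
      have s2 := Real.sq_sqrt q2.le
      rw [hBs, ← sq, mul_pow, mul_pow, inv_pow, inv_pow, s1, s2, div_eq_mul_inv, mul_inv]
      ring
    rw [e]
    rcases hZ i j with h | h
    · simp [h]
    · rw [h, one_mul, one_mul]
      obtain ⟨b1, b2⟩ := hWbounds i j h
      have b0 : 0 ≤ W i j := hwlow.le.trans b1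
      exact div_le_div₀ (sq_nonneg _) (pow_le_pow_left₀ b0 b2 2) (mul_pos p1 p2)
        (mul_le_mul (hA i) (hC j) p2.le q1.le)
  have rowb : ∀ i, (Bs * Bsᵀ) i i ≤ (ωbar / wlow) ^ 2 / m := fun i => by
    rw [Matrix.mul_apply]
    simp only [Matrix.transpose_apply]
    refine (Finset.sum_le_sum fun j _ => key i j).trans (le_of_eq ?_)
    rw [← Finset.sum_mul]
    have := (hNpos i).ne'
    have := hmpos.ne'
    have := hwlow.ne'
    field_simp
  calc (Bs * Bsᵀ).trace = ∑ i, (Bs * Bsᵀ) i i := rfl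
    _ ≤ ∑ _i : R, (ωbar / wlow) ^ 2 / m := Finset.sum_le_sum fun i _ => rowb i
    _ = _ := by
      rw [Finset.sum_const, Finset.card_univ, nsmul_eq_mul]
      ring
end
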